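/- For all integers p, k with 1 ≤ p ≤ k, the identity G_p^k − G_{p−1}^{k−1} = (1 − q_k)·(1 − x_k)·(Ḡ_p^{k−1} − Ḡ_{p−1}^{k−1}) holds in ℤ[q_1, q_2, …, x_1, x_2, …]. -/

import Mathlib

open MvPolynomial Finset

noncomputable section

/-- The polynomial ring `ℤ[q_1, q_2, …, x_1, x_2, …]`; the variable `Sum.inl i` is `q_i`
and `Sum.inr i` is `x_i`. -/
abbrev P : Type := MvPolynomial (ℕ ⊕ ℕ) ℤ

/-- The variable `q_i`. -/
def qv (i : ℕ) : P := X (Sum.inl i)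

/-- The variable `x_i`. -/
def xv (i : ℕ) : P := X (Sum.inr i)

/-- The polynomial `F_p^k`, defined as `0` unless `0 ≤ p ≤ k`. -/
def Fp (p k : ℤ) : P :=
  if 0 ≤ p ∧ p ≤ k then
    ∑ I ∈ (Finset.Icc 1 k.toNat).powersetCard p.toNat,
      (∏ i ∈ I, (1 - xv i)) * ∏ i ∈ I.filter (fun i => i + 1 ∉ I), (1 - qv i)
  else 0

/-- The substitution `q_k ↦ 0`. -/
def setQ (k : ℕ) : P →ₐ[ℤ] P :=
  aeval (fun v => if v = Sum.inl k then 0 else X v)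

/-- The polynomial `Ê_p^k = Σ_{i=0}^p (−1)^i C(k−i, p−i) F_i^k`, defined as `0` unless
`0 ≤ p ≤ k`. -/
def Ehat (p k : ℤ) : P :=
  if 0 ≤ p ∧ p ≤ k then
    ∑ i ∈ Finset.range (p.toNat + 1),
      (-1 : P) ^ i * (Nat.choose (k.toNat - i) (p.toNat - i) : P) * Fp (i : ℤ) k
  else 0

/-- `Ē_p^k`, i.e. `Ê_p^k` with `q_k` set to `0`. -/
def Ebar (p k : ℤ) : P := setQ k.toNat (Ehat p k)

/-- The polynomial `G_p^k`: `G_0^k = 1`, and for `p ≥ 1`,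
`G_p^k = Σ_{i=p}^k (−1)^{i−p} C(i−1, p−1) Ê_i^k`; it is `0` unless `0 ≤ p ≤ k`. -/
def Gq (p k : ℤ) : P :=
  if 0 ≤ p ∧ p ≤ k then
    if p = 0 then 1
    else
      ∑ i ∈ Finset.Icc p k,
        (-1 : P) ^ (i - p).toNat * (Nat.choose (i - 1).toNat (p - 1).toNat : P) * Ehat i k
  else 0

/-- `Ḡ_p^k`, i.e. `G_p^k` with `q_k` set to `0`. -/
def Gbar (p k : ℤ) : P := setQ k.toNat (Gq p k)

/-- The summand of `F_p^k` indexed by the set `I`. -/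
def weight (I : Finset ℕ) : P :=
  (∏ i ∈ I, (1 - xv i)) * ∏ i ∈ I.filter (fun i => i + 1 ∉ I), (1 - qv i)

lemma setQ_qv (n i : ℕ) : setQ n (qv i) = if i = n then 0 else qv i := by
  simp [setQ, qv]

lemma setQ_xv (n i : ℕ) : setQ n (xv i) = xv i := by
  simp [setQ, xv]

lemma weight_insert_succ {n : ℕ} {I : Finset ℕ} (hI : I ⊆ Icc 1 n) :
    weight (insert (n + 1) I)
      = (1 - qv (n + 1)) * (1 - xv (n + 1)) * setQ n (weight I) := by
  have hle : ∀ i ∈ I, i ≤ n := fun i hi => (mem_Icc.mp (hI hi)).2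
  have hn : n + 1 ∉ I := fun h => by have := hle _ h; omega
  have hfilter : (insert (n + 1) I).filter (fun i => i + 1 ∉ insert (n + 1) I)
      = insert (n + 1) ((I.filter (fun i => i + 1 ∉ I)).filter (fun i => i ≠ n)) := by
    ext i
    have := hle i
    have := hle (i + 1)
    simp only [mem_filter, mem_insert]
    grind
  have hn' : n + 1 ∉ (I.filter (fun i => i + 1 ∉ I)).filter (fun i => i ≠ n) := by
    simp [hn]
  have hq : ∏ i ∈ (I.filter (fun i => i + 1 ∉ I)).filter (fun i => i ≠ n), (1 - qv i)
      = ∏ i ∈ I.filter (fun i => i + 1 ∉ I), (1 - setQ n (qv i)) := by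
    rw [prod_filter]
    refine prod_congr rfl fun i _ => ?_
    by_cases h : i = n <;> simp [setQ_qv, h]
  rw [weight, hfilter, prod_insert hn, prod_insert hn', hq]
  simp only [weight, map_mul, map_prod, map_sub, map_one, setQ_xv]
  ring

/-- The generating polynomial `Σ_I w(I) (1 - z)^#I z^(n - #I)` over the subsets `I` of
`{1, …, n}`. -/
def subsetGen {R : Type*} [CommRing R] (w : Finset ℕ → R) (n : ℕ) : Polynomial R :=
  ∑ I ∈ (Icc 1 n).powerset,
    Polynomial.C (w I) * ((1 - Polynomial.X) ^ #I * Polynomial.X ^ (n - #I))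

lemma subsetGen_succ {R : Type*} [CommRing R] (w : Finset ℕ → R) (φ : R →+* R) (a : R) (n : ℕ)
    (hw : ∀ I ⊆ Icc 1 n, w (insert (n + 1) I) = a * φ (w I)) :
    subsetGen w (n + 1) = Polynomial.X * subsetGen w n
      + Polynomial.C a * (1 - Polynomial.X) * (subsetGen w n).map φ := by
  have hn : n + 1 ∉ Icc 1 n := by simp
  have hIcc : Icc 1 (n + 1) = insert (n + 1) (Icc 1 n) := by
    ext i
    simp only [mem_Icc, mem_insert]
    omega
  rw [subsetGen, hIcc, sum_powerset_insert hn, subsetGen, Polynomial.map_sum, mul_sum, mul_sum]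
  congr 1
  · refine sum_congr rfl fun I hI => ?_
    have hc : #I ≤ n := by simpa using card_le_card (mem_powerset.mp hI)
    rw [Nat.succ_sub hc, pow_succ]
    ring
  · refine sum_congr rfl fun I hI => ?_
    rw [mem_powerset] at hI
    rw [card_insert_of_notMem fun h => hn (hI h), hw I hI, Nat.add_sub_add_right]
    simp only [Polynomial.map_mul, Polynomial.map_pow, Polynomial.map_sub, Polynomial.map_one,
      Polynomial.map_X, Polynomial.map_C, Polynomial.C_mul]
    ring

lemma Fp_natCast (p n : ℕ) : Fp p n = ∑ I ∈ (Icc 1 n).powersetCard p, weight I := by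
  by_cases h : p ≤ n
  · simp [Fp, weight, h]
  · rw [Fp, if_neg (by omega), powersetCard_eq_empty.mpr (by simpa using h), sum_empty]

lemma subsetGen_weight (n : ℕ) :
    subsetGen weight n = ∑ i ∈ range (n + 1),
      Polynomial.C (Fp i n) * ((1 - Polynomial.X) ^ i * Polynomial.X ^ (n - i)) := by
  rw [subsetGen, sum_powerset]
  simp only [Nat.card_Icc, Nat.add_sub_cancel]
  refine sum_congr rfl fun i _ => ?_
  rw [Fp_natCast, map_sum, sum_mul]
  refine sum_congr rfl fun I hI => ?_
  rw [(mem_powersetCard.mp hI).2]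

lemma sum_binomial_transform_mul_pow {R : Type*} [CommRing R] (f : ℕ → R) (y : R) (n : ℕ) :
    ∑ p ∈ range (n + 1),
        (∑ i ∈ range (p + 1), (-1) ^ i * ((n - i).choose (p - i) : R) * f i) * y ^ p
      = ∑ i ∈ range (n + 1), f i * ((-y) ^ i * (y + 1) ^ (n - i)) := by
  simp_rw [sum_mul]
  rw [sum_comm' (t' := range (n + 1)) (s' := fun i => Ico i (n + 1))
    (by intro p i; simp only [mem_range, mem_Ico]; omega)]
  refine sum_congr rfl fun i hi => ?_
  rw [mem_range] at hi
  rw [sum_Ico_eq_sum_range, add_pow, Nat.succ_sub (Nat.le_of_lt_succ hi), mul_sum, mul_sum]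
  refine sum_congr rfl fun j _ => ?_
  rw [Nat.add_sub_cancel_left, one_pow, pow_add, neg_pow y]
  ring

lemma sum_alternating_binomial_mul_pow {R : Type*} [CommRing R] (e : ℕ → R) (z : R) (n : ℕ) :
    ∑ q ∈ range n, (∑ j ∈ Ico q n, (-1) ^ (j - q) * (j.choose q : R) * e j) * z ^ q
      = ∑ j ∈ range n, e j * (z - 1) ^ j := by
  simp_rw [sum_mul]
  rw [sum_comm' (t' := range n) (s' := fun j => range (j + 1))
    (by intro q j; simp only [mem_range, mem_Ico]; omega)]
  refine sum_congr rfl fun j _ => ?_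
  rw [sub_eq_add_neg, add_pow, mul_sum]
  refine sum_congr rfl fun q _ => ?_
  ring

lemma Ehat_natCast {p n : ℕ} (h : p ≤ n) :
    Ehat p n = ∑ i ∈ range (p + 1), (-1) ^ i * ((n - i).choose (p - i) : P) * Fp i n := by
  simp [Ehat, h]

lemma Ehat_zero (n : ℕ) : Ehat 0 n = 1 := by
  simp [Ehat, Fp]

lemma sum_Ehat_eq_subsetGen (n : ℕ) :
    ∑ p ∈ range (n + 1), Polynomial.C (Ehat p n) * (Polynomial.X - 1) ^ p = subsetGen weight n := by
  have key := sum_binomial_transform_mul_pow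
    (fun i : ℕ => Polynomial.C (Fp i n)) (Polynomial.X - 1) n
  simp only [neg_sub, sub_add_cancel] at key
  rw [subsetGen_weight, ← key]
  refine sum_congr rfl fun p hp => ?_
  rw [Ehat_natCast (Nat.le_of_lt_succ (mem_range.mp hp))]
  simp

lemma Gq_zero (n : ℕ) : Gq 0 n = 1 := by
  simp [Gq]

lemma Gq_eq_zero {p n : ℕ} (h : n < p) : Gq p n = 0 := by
  rw [Gq, if_neg (by omega)]

lemma Gq_succ {q n : ℕ} (h : q < n) :
    Gq (q + 1 : ℕ) n
      = ∑ j ∈ Ico q n, (-1) ^ (j - q) * (j.choose q : P) * Ehat (j + 1 : ℕ) n := by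
  rw [Gq, if_pos (by omega), if_neg (by omega)]
  symm
  refine sum_bij (fun j _ => ((j + 1 : ℕ) : ℤ)) ?_ ?_ ?_ ?_
  · intro j hj
    simp only [mem_Ico, mem_Icc] at *
    omega
  · intro a _ b _ hab
    simpa using hab
  · intro b hb
    rw [mem_Icc] at hb
    refine ⟨(b - 1).toNat, ?_, ?_⟩
    · rw [mem_Ico]
      omega
    · omega
  · intro j _
    have h₁ : (((j + 1 : ℕ) : ℤ) - ((q + 1 : ℕ) : ℤ)).toNat = j - q := by omega
    have h₂ : (((j + 1 : ℕ) : ℤ) - 1).toNat = j := by omega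
    have h₃ : (((q + 1 : ℕ) : ℤ) - 1).toNat = q := by omega
    rw [h₁, h₂, h₃]

/-- The generating polynomial `Σ_p G_p^n z^p`. -/
def genG (n : ℕ) : Polynomial P :=
  ∑ p ∈ range (n + 1), Polynomial.C (Gq p n) * Polynomial.X ^ p

lemma coeff_genG (p n : ℕ) : (genG n).coeff p = Gq p n := by
  rw [genG, Polynomial.finsetSum_coeff]
  simp only [Polynomial.coeff_C_mul_X_pow, sum_ite_eq, mem_range]
  split_ifs with h
  · rfl
  · exact (Gq_eq_zero (by omega)).symm

lemma sub_one_mul_sum_eq {R : Type*} [CommRing R] (e g : ℕ → R) (n : ℕ)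
    (he : e 0 = 1) (hg : g 0 = 1)
    (hge : ∀ q < n, g (q + 1) = ∑ j ∈ Ico q n, (-1) ^ (j - q) * (j.choose q : R) * e (j + 1)) :
    (Polynomial.X - 1) * ∑ p ∈ range (n + 1), Polynomial.C (g p) * Polynomial.X ^ p
      = Polynomial.X * (∑ p ∈ range (n + 1), Polynomial.C (e p) * (Polynomial.X - 1) ^ p)
        - 1 := by
  have key := sum_alternating_binomial_mul_pow
    (fun j : ℕ => Polynomial.C (e (j + 1))) Polynomial.X n
  have hG : ∑ q ∈ range n, Polynomial.C (g (q + 1)) * Polynomial.X ^ (q + 1)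
      = Polynomial.X * ∑ j ∈ range n, Polynomial.C (e (j + 1)) * (Polynomial.X - 1) ^ j := by
    rw [← key, mul_sum]
    refine sum_congr rfl fun q hq => ?_
    rw [hge q (mem_range.mp hq), pow_succ', mul_left_comm]
    simp
  have hE : ∑ j ∈ range n, Polynomial.C (e (j + 1)) * (Polynomial.X - 1) ^ (j + 1)
      = (Polynomial.X - 1)
        * ∑ j ∈ range n, Polynomial.C (e (j + 1)) * (Polynomial.X - 1) ^ j := by
    rw [mul_sum]
    exact sum_congr rfl fun j _ => by rw [pow_succ', mul_left_comm]
  rw [sum_range_succ', sum_range_succ', hG, hE, he, hg]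
  simp only [map_one, pow_zero, mul_one]
  ring

lemma sub_one_mul_genG (n : ℕ) :
    (Polynomial.X - 1) * genG n = Polynomial.X * subsetGen weight n - 1 := by
  rw [genG, ← sum_Ehat_eq_subsetGen]
  exact sub_one_mul_sum_eq (fun p : ℕ => Ehat p n) (fun p : ℕ => Gq p n) n
    (Ehat_zero n) (Gq_zero n) fun q hq => Gq_succ hq

lemma coeff_succ_sub_coeff {R : Type*} [CommRing R] (φ : R →+* R) (a : R)
    {g g' f f' : Polynomial R}
    (hg : (Polynomial.X - 1) * g = Polynomial.X * f - 1)
    (hg' : (Polynomial.X - 1) * g' = Polynomial.X * f' - 1)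
    (hf' : f' = Polynomial.X * f + Polynomial.C a * (1 - Polynomial.X) * f.map φ) (p : ℕ) :
    g'.coeff (p + 1) - g.coeff p = a * (φ (g.coeff (p + 1)) - φ (g.coeff p)) := by
  have hbar := congrArg (Polynomial.map φ) hg
  simp only [Polynomial.map_mul, Polynomial.map_sub, Polynomial.map_one,
    Polynomial.map_X] at hbar
  have hX : IsRegular (Polynomial.X - 1 : Polynomial R) := by
    simpa using (Polynomial.monic_X_sub_C (1 : R)).isRegular
  have hrec : g' = Polynomial.X * g + 1
      - Polynomial.C a * ((Polynomial.X - 1) * g.map φ + 1) := by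
    apply hX.left
    linear_combination
      hg' + Polynomial.X * hf' - Polynomial.X * hg
        + Polynomial.C a * (Polynomial.X - 1) * hbar
  have key := congrArg (fun h => Polynomial.coeff h (p + 1)) hrec
  simp only [sub_mul, one_mul, Polynomial.coeff_sub, Polynomial.coeff_add,
    Polynomial.coeff_C_mul, Polynomial.coeff_X_mul, Polynomial.coeff_map, Polynomial.coeff_one,
    Nat.succ_ne_zero, if_false] at key
  linear_combination key

/-- For all integers `1 ≤ p ≤ k`,
`G_p^k − G_{p−1}^{k−1} = (1 − q_k)·(1 − x_k)·(Ḡ_p^{k−1} − Ḡ_{p−1}^{k−1})`. -/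
theorem statement12 (p k : ℤ) (hp : 1 ≤ p) (hpk : p ≤ k) :
    Gq p k - Gq (p - 1) (k - 1)
      = (1 - qv k.toNat) * (1 - xv k.toNat) * (Gbar p (k - 1) - Gbar (p - 1) (k - 1)) := by
  obtain ⟨p, rfl⟩ : ∃ m : ℕ, p = (m + 1 : ℕ) := ⟨(p - 1).toNat, by omega⟩
  obtain ⟨n, rfl⟩ : ∃ m : ℕ, k = (m + 1 : ℕ) := ⟨(k - 1).toNat, by omega⟩
  have hp' : ((p + 1 : ℕ) : ℤ) - 1 = p := by omega
  have hn' : ((n + 1 : ℕ) : ℤ) - 1 = n := by omega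
  rw [hp', hn', Gbar, Gbar, Int.toNat_natCast, Int.toNat_natCast]
  rw [← coeff_genG, ← coeff_genG, ← coeff_genG]
  exact coeff_succ_sub_coeff (setQ n).toRingHom _ (sub_one_mul_genG n)
    (sub_one_mul_genG (n + 1))
    (subsetGen_succ weight _ _ n fun I hI => weight_insert_succ hI) p
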